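/- arXiv:1912.00105 — 5 statements merged into one kernel-verified Lean document; each statement's English description precedes it below -/
import Mathlib

section
/- Let p1,...,p6 be real, p7 = p1*p4 + p2*p6 - p2*p3 - p4^2, p8 = p3*p4 - p2*p5, p9 = p1*p5 + p3*p6 - p4*p5 - p3^2, let (r,s,t) be a permutation of (1,2,3), A = A^3_r(p1,...,p6), Omega an open subset of R^3, and F = (f_1,f_2,f_3) : Omega -> R^3 Fréchet differentiable on Omega. Then the components of F satisfy, at every point of Omega, the six generalized Cauchy-Riemann equations ∂f_r/∂x_s = p7·∂f_s/∂x_r + p8·∂f_t/∂x_r, ∂f_r/∂x_t = p8·∂f_s/∂x_r + p9·∂f_t/∂x_r, ∂f_s/∂x_s = ∂f_r/∂x_r + p1·∂f_s/∂x_r + p3·∂f_t/∂x_r, ∂f_s/∂x_t = p3·∂f_s/∂x_r + p5·∂f_t/∂x_r, ∂f_t/∂x_s = p2·∂f_s/∂x_r + p4·∂f_t/∂x_r, ∂f_t/∂x_t = ∂f_r/∂x_r + p4·∂f_s/∂x_r + p6·∂f_t/∂x_r, if and only if F is A-algebrizable on Omega. -/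
noncomputable section

/-- The `i`-th standard basis vector of `ℝ³`. -/
def e3 (i : Fin 3) : Fin 3 → ℝ := Pi.single i 1

/-- `A`-algebrizability (Lorch differentiability) of a vector field on an open set. -/
def IsAlgebrizable (mul : (Fin 3 → ℝ) → (Fin 3 → ℝ) → (Fin 3 → ℝ))
    (Ω : Set (Fin 3 → ℝ)) (F : (Fin 3 → ℝ) → (Fin 3 → ℝ)) : Prop :=
  ∃ F' : (Fin 3 → ℝ) → (Fin 3 → ℝ), ∀ w ∈ Ω,
    DifferentiableAt ℝ F w ∧ ∀ ξ, fderiv ℝ F w ξ = mul (F' w) ξ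

theorem e3_apply (i j : Fin 3) : e3 i j = if j = i then 1 else 0 := Pi.single_apply i 1 j

/-- A vector of `ℝ³` decomposes along the standard basis listed in any order. -/
theorem eq_sum_smul_e3 {r s t : Fin 3} (hrs : r ≠ s) (hrt : r ≠ t) (hst : s ≠ t)
    (u : Fin 3 → ℝ) : u = u r • e3 r + u s • e3 s + u t • e3 t := by
  ext i
  fin_cases r <;> fin_cases s <;> fin_cases t <;> simp at hrs hrt hst <;>
    fin_cases i <;> simp [e3]

theorem vec3_ext {r s t : Fin 3} (hrs : r ≠ s) (hrt : r ≠ t) (hst : s ≠ t)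
    {u v : Fin 3 → ℝ} (hr : u r = v r) (hs : u s = v s) (ht : u t = v t) : u = v := by
  rw [eq_sum_smul_e3 hrs hrt hst u, eq_sum_smul_e3 hrs hrt hst v, hr, hs, ht]

theorem linearMap_ext_e3 {r s t : Fin 3} (hrs : r ≠ s) (hrt : r ≠ t) (hst : s ≠ t)
    {f g : (Fin 3 → ℝ) → (Fin 3 → ℝ)} (hf : IsLinearMap ℝ f) (hg : IsLinearMap ℝ g)
    (hr : f (e3 r) = g (e3 r)) (hs : f (e3 s) = g (e3 s)) (ht : f (e3 t) = g (e3 t))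
    (ξ : Fin 3 → ℝ) : f ξ = g ξ := by
  rw [eq_sum_smul_e3 hrs hrt hst ξ]
  simp only [hf.map_add, hf.map_smul, hg.map_add, hg.map_smul, hr, hs, ht]

theorem IsLinearMap.apply_eq_sum_smul_e3 {r s t : Fin 3}
    (hrs : r ≠ s) (hrt : r ≠ t) (hst : s ≠ t)
    {f : (Fin 3 → ℝ) → (Fin 3 → ℝ)} (hf : IsLinearMap ℝ f) (u : Fin 3 → ℝ) :
    f u = u r • f (e3 r) + u s • f (e3 s) + u t • f (e3 t) := by
  conv_lhs => rw [eq_sum_smul_e3 hrs hrt hst u]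
  simp only [hf.map_add, hf.map_smul]

/-- Let `A = A³_r(p1,...,p6)`, with `p7,p8,p9` given by the commutativity equations,
`Ω ⊆ ℝ³` open, and `F = (f₁,f₂,f₃)` Fréchet differentiable on `Ω`.  Then `F` satisfies
the six generalized Cauchy-Riemann equations at every point of `Ω` iff `F` is
`A`-algebrizable on `Ω`. -/
theorem stmt7 (p1 p2 p3 p4 p5 p6 p7 p8 p9 : ℝ)
    (hp7 : p7 = p1 * p4 + p2 * p6 - p2 * p3 - p4 ^ 2)
    (hp8 : p8 = p3 * p4 - p2 * p5)
    (hp9 : p9 = p1 * p5 + p3 * p6 - p4 * p5 - p3 ^ 2)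
    (r s t : Fin 3) (hrs : r ≠ s) (hrt : r ≠ t) (hst : s ≠ t)
    (mul : (Fin 3 → ℝ) → (Fin 3 → ℝ) → (Fin 3 → ℝ))
    (hlin_left : ∀ y, IsLinearMap ℝ (fun x => mul x y))
    (hlin_right : ∀ x, IsLinearMap ℝ (mul x))
    (hrr : mul (e3 r) (e3 r) = e3 r)
    (hrs' : mul (e3 r) (e3 s) = e3 s) (hsr : mul (e3 s) (e3 r) = e3 s)
    (hrt' : mul (e3 r) (e3 t) = e3 t) (htr : mul (e3 t) (e3 r) = e3 t)
    (hss : mul (e3 s) (e3 s) = p7 • e3 r + p1 • e3 s + p2 • e3 t)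
    (hst' : mul (e3 s) (e3 t) = p8 • e3 r + p3 • e3 s + p4 • e3 t)
    (hts : mul (e3 t) (e3 s) = p8 • e3 r + p3 • e3 s + p4 • e3 t)
    (htt : mul (e3 t) (e3 t) = p9 • e3 r + p5 • e3 s + p6 • e3 t)
    (Ω : Set (Fin 3 → ℝ)) (hΩ : IsOpen Ω)
    (F : (Fin 3 → ℝ) → (Fin 3 → ℝ))
    (hF : ∀ w ∈ Ω, DifferentiableAt ℝ F w) :
    (∀ w ∈ Ω,
        fderiv ℝ F w (e3 s) r
          = p7 * fderiv ℝ F w (e3 r) s + p8 * fderiv ℝ F w (e3 r) t ∧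
        fderiv ℝ F w (e3 t) r
          = p8 * fderiv ℝ F w (e3 r) s + p9 * fderiv ℝ F w (e3 r) t ∧
        fderiv ℝ F w (e3 s) s
          = fderiv ℝ F w (e3 r) r + p1 * fderiv ℝ F w (e3 r) s
            + p3 * fderiv ℝ F w (e3 r) t ∧
        fderiv ℝ F w (e3 t) s
          = p3 * fderiv ℝ F w (e3 r) s + p5 * fderiv ℝ F w (e3 r) t ∧
        fderiv ℝ F w (e3 s) t
          = p2 * fderiv ℝ F w (e3 r) s + p4 * fderiv ℝ F w (e3 r) t ∧
        fderiv ℝ F w (e3 t) t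
          = fderiv ℝ F w (e3 r) r + p4 * fderiv ℝ F w (e3 r) s
            + p6 * fderiv ℝ F w (e3 r) t)
      ↔ IsAlgebrizable mul Ω F := by
  have mul_r (u) : mul u (e3 r) = u := by
    rw [(hlin_left (e3 r)).apply_eq_sum_smul_e3 hrs hrt hst u, hrr, hsr, htr]
    exact (eq_sum_smul_e3 hrs hrt hst u).symm
  have mul_s (u) := (hlin_left (e3 s)).apply_eq_sum_smul_e3 hrs hrt hst u
  have mul_t (u) := (hlin_left (e3 t)).apply_eq_sum_smul_e3 hrs hrt hst u
  simp only [hrs', hss, hts] at mul_s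
  simp only [hrt', hst', htt] at mul_t
  constructor
  · intro h
    refine ⟨fun w => fderiv ℝ F w (e3 r), fun w hw => ⟨hF w hw, ?_⟩⟩
    obtain ⟨h1, h2, h3, h4, h5, h6⟩ := h w hw
    refine linearMap_ext_e3 hrs hrt hst (fderiv ℝ F w).toLinearMap.isLinear
      (hlin_right _) (mul_r _).symm ?_ ?_
    · refine vec3_ext hrs hrt hst ?_ ?_ ?_ <;> rw [mul_s] <;>
        simp [e3_apply, hrs, hrt, hst, hrs.symm, hrt.symm, hst.symm, h1, h3, h5] <;> ring
    · refine vec3_ext hrs hrt hst ?_ ?_ ?_ <;> rw [mul_t] <;>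
        simp [e3_apply, hrs, hrt, hst, hrs.symm, hrt.symm, hst.symm, h2, h4, h6] <;> ring
  · rintro ⟨F', h⟩ w hw
    obtain ⟨-, h⟩ := h w hw
    simp only [h, mul_r, mul_s, mul_t]
    refine ⟨?_, ?_, ?_, ?_, ?_, ?_⟩ <;>
      simp [e3_apply, hrs, hrt, hst, hrs.symm, hrt.symm, hst.symm] <;> ring
end
end

section
/- Let p1, p2 be real, (r,s,t) a permutation of (1,2,3), A = A^3_{r,s}(p1,p2), Omega an open subset of R^3, and F = (f_1,f_2,f_3) : Omega -> R^3 Fréchet differentiable on Omega. Then the components of F satisfy, at every point of Omega, the equations ∂f_r/∂x_s = 0, ∂f_r/∂x_t = 0, ∂f_s/∂x_r = 0, ∂f_t/∂x_r = 0, ∂f_s/∂x_t = p1·∂f_t/∂x_s, and ∂f_t/∂x_t = ∂f_s/∂x_s + p2·∂f_t/∂x_s, if and only if F is A-algebrizable on Omega. -/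
noncomputable section

theorem eq_sum_e3 {r s t : Fin 3} (hrs : r ≠ s) (hrt : r ≠ t) (hst : s ≠ t) (x : Fin 3 → ℝ) :
    x = x r • e3 r + x s • e3 s + x t • e3 t := by
  ext i
  have hi : i = r ∨ i = s ∨ i = t := by omega
  rcases hi with rfl | rfl | rfl <;>
    simp [e3, hrs, hrt, hst, hrs.symm, hrt.symm, hst.symm]

theorem eq_of_eq_on_e3 {r s t : Fin 3} (hrs : r ≠ s) (hrt : r ≠ t) (hst : s ≠ t)
    {f g : (Fin 3 → ℝ) → (Fin 3 → ℝ)} (hf : IsLinearMap ℝ f) (hg : IsLinearMap ℝ g)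
    (hr : f (e3 r) = g (e3 r)) (hs : f (e3 s) = g (e3 s)) (ht : f (e3 t) = g (e3 t))
    (x : Fin 3 → ℝ) : f x = g x := by
  rw [eq_sum_e3 hrs hrt hst x]
  simp only [hf.map_add, hf.map_smul, hg.map_add, hg.map_smul, hr, hs, ht]

/-- Let `A = A³_{r,s}(p1,p2)`, `Ω ⊆ ℝ³` open, and `F = (f₁,f₂,f₃)` Fréchet
differentiable on `Ω`.  Then `F` satisfies, at every point of `Ω`, the equations
`∂f_r/∂x_s = 0`, `∂f_r/∂x_t = 0`, `∂f_s/∂x_r = 0`, `∂f_t/∂x_r = 0`,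
`∂f_s/∂x_t = p1·∂f_t/∂x_s`, `∂f_t/∂x_t = ∂f_s/∂x_s + p2·∂f_t/∂x_s` iff `F` is
`A`-algebrizable on `Ω`. -/
theorem stmt8 (p1 p2 : ℝ)
    (r s t : Fin 3) (hrs : r ≠ s) (hrt : r ≠ t) (hst : s ≠ t)
    (mul : (Fin 3 → ℝ) → (Fin 3 → ℝ) → (Fin 3 → ℝ))
    (hlin_left : ∀ y, IsLinearMap ℝ (fun x => mul x y))
    (hlin_right : ∀ x, IsLinearMap ℝ (mul x))
    (hrr : mul (e3 r) (e3 r) = e3 r)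
    (hrs' : mul (e3 r) (e3 s) = 0) (hsr : mul (e3 s) (e3 r) = 0)
    (hrt' : mul (e3 r) (e3 t) = 0) (htr : mul (e3 t) (e3 r) = 0)
    (hss : mul (e3 s) (e3 s) = e3 s)
    (hst' : mul (e3 s) (e3 t) = e3 t) (hts : mul (e3 t) (e3 s) = e3 t)
    (htt : mul (e3 t) (e3 t) = p1 • e3 s + p2 • e3 t)
    (Ω : Set (Fin 3 → ℝ)) (hΩ : IsOpen Ω)
    (F : (Fin 3 → ℝ) → (Fin 3 → ℝ))
    (hF : ∀ w ∈ Ω, DifferentiableAt ℝ F w) :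
    (∀ w ∈ Ω,
        fderiv ℝ F w (e3 s) r = 0 ∧
        fderiv ℝ F w (e3 t) r = 0 ∧
        fderiv ℝ F w (e3 r) s = 0 ∧
        fderiv ℝ F w (e3 r) t = 0 ∧
        fderiv ℝ F w (e3 t) s = p1 * fderiv ℝ F w (e3 s) t ∧
        fderiv ℝ F w (e3 t) t = fderiv ℝ F w (e3 s) s + p2 * fderiv ℝ F w (e3 s) t)
      ↔ IsAlgebrizable mul Ω F := by
  have hmul (x y : Fin 3 → ℝ) :
      mul x y = x r • mul (e3 r) y + x s • mul (e3 s) y + x t • mul (e3 t) y := by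
    conv_lhs => rw [eq_sum_e3 hrs hrt hst x]
    rw [(hlin_left y).map_add, (hlin_left y).map_add, (hlin_left y).map_smul,
      (hlin_left y).map_smul, (hlin_left y).map_smul]
  have hmul_r (x : Fin 3 → ℝ) : mul x (e3 r) = x r • e3 r := by
    simp [hmul x, hrr, hsr, htr]
  have hmul_s (x : Fin 3 → ℝ) : mul x (e3 s) = x s • e3 s + x t • e3 t := by
    simp [hmul x, hrs', hss, hts]
  have hmul_t (x : Fin 3 → ℝ) :
      mul x (e3 t) = x s • e3 t + x t • (p1 • e3 s + p2 • e3 t) := by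
    simp [hmul x, hrt', hst', htt]
  constructor
  · intro h
    refine ⟨fun w => fderiv ℝ F w (e3 r + e3 s), fun w hw => ⟨hF w hw, ?_⟩⟩
    obtain ⟨h1, h2, h3, h4, h5, h6⟩ := h w hw
    refine eq_of_eq_on_e3 hrs hrt hst (fderiv ℝ F w).toLinearMap.isLinear (hlin_right _) ?_ ?_ ?_
    · rw [hmul_r, eq_sum_e3 hrs hrt hst (fderiv ℝ F w (e3 r))]
      simp [h1, h3, h4]
    · rw [hmul_s, eq_sum_e3 hrs hrt hst (fderiv ℝ F w (e3 s))]
      simp [h1, h3, h4]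
    · rw [hmul_t, eq_sum_e3 hrs hrt hst (fderiv ℝ F w (e3 t))]
      simp only [map_add, Pi.add_apply, h2, h3, h4, h5, h6]
      module
  · rintro ⟨F', hF'⟩ w hw
    have h := (hF' w hw).2
    rw [h, h, h, hmul_r, hmul_s, hmul_t]
    simp [e3, hrs, hrt, hst, hrs.symm, hrt.symm, hst.symm, mul_comm]
end
end

section
/- Let A = A^3_r(p1,...,p6) with unit e = e_r, let F be A-algebrizable on an open set Omega in R^3, let N be an open subset of Omega(F,A*) = {w in Omega : F(w) is invertible in A}, and let H = (h_1, h_2, h_3) : N -> R^3 be an A-antiderivative of e/F on N, i.e., at every w in N, H is Fréchet differentiable with differential xi |-> (F(w))^{-1}·xi (product in A). Then for every w in N: <∇h_s(w), F(w)> = 0, <∇h_t(w), F(w)> = 0, and <∇h_r(w), F(w)> = 1; in particular h_s and h_t are first integrals of F on N. -/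
noncomputable section

/-- A linear map on `ℝ³` is determined coordinatewise by its values on the standard basis. -/
lemma sum_apply_e3_mul (L : (Fin 3 → ℝ) →ₗ[ℝ] (Fin 3 → ℝ)) (x : Fin 3 → ℝ) (i : Fin 3) :
    ∑ j : Fin 3, L (e3 j) i * x j = L x i := by
  conv_rhs => rw [L.pi_apply_eq_sum_univ x]
  simp only [Finset.sum_apply, Pi.smul_apply, smul_eq_mul]
  refine Finset.sum_congr rfl fun j _ => ?_
  have : (fun k => if j = k then (1 : ℝ) else 0) = e3 j := by
    ext k
    simp [e3, Pi.single_apply, eq_comm]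
  rw [this, mul_comm]

/-- A bilinear product on `ℝ³` which commutes on the standard basis is commutative. -/
lemma mul_comm_of_e3 (mul : (Fin 3 → ℝ) → (Fin 3 → ℝ) → (Fin 3 → ℝ))
    (hl : ∀ y, IsLinearMap ℝ (fun x => mul x y)) (hr : ∀ x, IsLinearMap ℝ (mul x))
    (h : ∀ i j, mul (e3 i) (e3 j) = mul (e3 j) (e3 i)) (x y : Fin 3 → ℝ) :
    mul x y = mul y x := by
  let B : (Fin 3 → ℝ) →ₗ[ℝ] (Fin 3 → ℝ) →ₗ[ℝ] (Fin 3 → ℝ) :=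
    LinearMap.mk₂ ℝ mul (fun a b c => (hl c).map_add a b) (fun c a b => (hl b).map_smul c a)
      (fun a => (hr a).map_add) (fun c a b => (hr a).map_smul c b)
  have hB : B = B.flip := by
    refine LinearMap.ext_basis (Pi.basisFun ℝ (Fin 3)) (Pi.basisFun ℝ (Fin 3)) fun i j => ?_
    simpa [B, e3] using h i j
  exact LinearMap.congr_fun₂ hB x y

/-- Let `A = A³_r(p1,...,p6)` with unit `e_r`, `F` `A`-algebrizable on the open set
`Ω ⊆ ℝ³`, `N` an open subset of `Ω(F,A*)`, and `H = (h₁,h₂,h₃)` an `A`-antiderivative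
of `e/F` on `N` (at each `w ∈ N`, `H` is Fréchet differentiable with differential
`ξ ↦ (F(w))⁻¹·ξ`).  Then for each `w ∈ N`: `⟨∇h_s(w), F(w)⟩ = 0`,
`⟨∇h_t(w), F(w)⟩ = 0`, and `⟨∇h_r(w), F(w)⟩ = 1`; in particular `h_s` and `h_t` are
first integrals of `F` on `N`. -/
theorem stmt14 (p1 p2 p3 p4 p5 p6 p7 p8 p9 : ℝ)
    (hp7 : p7 = p1 * p4 + p2 * p6 - p2 * p3 - p4 ^ 2)
    (hp8 : p8 = p3 * p4 - p2 * p5)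
    (hp9 : p9 = p1 * p5 + p3 * p6 - p4 * p5 - p3 ^ 2)
    (r s t : Fin 3) (hrs : r ≠ s) (hrt : r ≠ t) (hst : s ≠ t)
    (mul : (Fin 3 → ℝ) → (Fin 3 → ℝ) → (Fin 3 → ℝ))
    (hlin_left : ∀ y, IsLinearMap ℝ (fun x => mul x y))
    (hlin_right : ∀ x, IsLinearMap ℝ (mul x))
    (hrr : mul (e3 r) (e3 r) = e3 r)
    (hrs' : mul (e3 r) (e3 s) = e3 s) (hsr : mul (e3 s) (e3 r) = e3 s)
    (hrt' : mul (e3 r) (e3 t) = e3 t) (htr : mul (e3 t) (e3 r) = e3 t)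
    (hss : mul (e3 s) (e3 s) = p7 • e3 r + p1 • e3 s + p2 • e3 t)
    (hst' : mul (e3 s) (e3 t) = p8 • e3 r + p3 • e3 s + p4 • e3 t)
    (hts : mul (e3 t) (e3 s) = p8 • e3 r + p3 • e3 s + p4 • e3 t)
    (htt : mul (e3 t) (e3 t) = p9 • e3 r + p5 • e3 s + p6 • e3 t)
    (Ω : Set (Fin 3 → ℝ)) (hΩ : IsOpen Ω)
    (F : (Fin 3 → ℝ) → (Fin 3 → ℝ)) (halg : IsAlgebrizable mul Ω F)
    (N : Set (Fin 3 → ℝ)) (hN : IsOpen N)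
    (hNsub : N ⊆ {w ∈ Ω | ∃ v, mul (F w) v = e3 r})
    (Finv : (Fin 3 → ℝ) → (Fin 3 → ℝ))
    (hFinv : ∀ w ∈ N, mul (F w) (Finv w) = e3 r)
    (H : (Fin 3 → ℝ) → (Fin 3 → ℝ))
    (hH : ∀ w ∈ N, DifferentiableAt ℝ H w ∧ ∀ ξ, fderiv ℝ H w ξ = mul (Finv w) ξ) :
    ∀ w ∈ N,
      (∑ j : Fin 3, fderiv ℝ H w (e3 j) s * F w j) = 0 ∧
      (∑ j : Fin 3, fderiv ℝ H w (e3 j) t * F w j) = 0 ∧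
      (∑ j : Fin 3, fderiv ℝ H w (e3 j) r * F w j) = 1 := by
  have hcases : ∀ i : Fin 3, i = r ∨ i = s ∨ i = t := by
    intro i
    omega
  have hcomm := mul_comm_of_e3 mul hlin_left hlin_right (by
    intro i j
    rcases hcases i with rfl | rfl | rfl <;> rcases hcases j with rfl | rfl | rfl <;>
      simp only [hrs', hsr, hrt', htr, hst', hts])
  intro w hw
  have key : ∀ i, ∑ j : Fin 3, fderiv ℝ H w (e3 j) i * F w j = e3 r i := by
    intro i
    rw [← hFinv w hw, hcomm, ← (hH w hw).2]
    exact sum_apply_e3_mul (fderiv ℝ H w : (Fin 3 → ℝ) →ₗ[ℝ] (Fin 3 → ℝ)) (F w) i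
  refine ⟨?_, ?_, ?_⟩ <;> rw [key]
  · simp [e3, hrs.symm]
  · simp [e3, hrt.symm]
  · simp [e3]
end
end

section
/- Let A be R^3 endowed with a commutative, associative, unital bilinear product, let F be A-algebrizable on an open set Omega in R^3, and let k, l be elements of R^3. Define the vector fields K_1(w) = k·F(w) and K_2(w) = l·F(w) (products in A). Then K_1 and K_2 are Fréchet differentiable on Omega and their Lie bracket vanishes: for every w in Omega, DK_2(w)(K_1(w)) = DK_1(w)(K_2(w)), where DK_i(w) denotes the Fréchet differential of K_i at w. -/
noncomputable section

/-- Differential of `g ∘ F` for `g` linear on `ℝ³`. -/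
theorem IsLinearMap.hasFDerivAt_comp {g : (Fin 3 → ℝ) → (Fin 3 → ℝ)} (hg : IsLinearMap ℝ g)
    {F : (Fin 3 → ℝ) → (Fin 3 → ℝ)} {w : Fin 3 → ℝ} (hF : DifferentiableAt ℝ F w) :
    HasFDerivAt (fun u => g (F u))
      ((LinearMap.toContinuousLinearMap (hg.mk' g)).comp (fderiv ℝ F w)) w :=
  (LinearMap.toContinuousLinearMap (hg.mk' g)).hasFDerivAt.comp w hF.hasFDerivAt

/-- Let `A` be `ℝ³` with a commutative, associative, unital bilinear product, `F`
`A`-algebrizable on an open set `Ω`, and `k, l ∈ ℝ³`.  The vector fields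
`K₁ = k·F` and `K₂ = l·F` are Fréchet differentiable on `Ω` and their Lie bracket
vanishes: `DK₂(w)(K₁(w)) = DK₁(w)(K₂(w))` for every `w ∈ Ω`. -/
theorem stmt18 (mul : (Fin 3 → ℝ) → (Fin 3 → ℝ) → (Fin 3 → ℝ))
    (hlin_left : ∀ y, IsLinearMap ℝ (fun x => mul x y))
    (hlin_right : ∀ x, IsLinearMap ℝ (mul x))
    (hcomm : ∀ x y, mul x y = mul y x)
    (hassoc : ∀ x y z, mul (mul x y) z = mul x (mul y z))
    (eu : Fin 3 → ℝ) (hunit : ∀ x, mul eu x = x)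
    (Ω : Set (Fin 3 → ℝ)) (hΩ : IsOpen Ω)
    (F : (Fin 3 → ℝ) → (Fin 3 → ℝ)) (halg : IsAlgebrizable mul Ω F)
    (k l : Fin 3 → ℝ) :
    ∀ w ∈ Ω,
      DifferentiableAt ℝ (fun u => mul k (F u)) w ∧
      DifferentiableAt ℝ (fun u => mul l (F u)) w ∧
      fderiv ℝ (fun u => mul l (F u)) w (mul k (F w))
        = fderiv ℝ (fun u => mul k (F u)) w (mul l (F w)) := by
  obtain ⟨F', hF'⟩ := halg
  intro w hw
  obtain ⟨hF, hd⟩ := hF' w hw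
  have hk := (hlin_right k).hasFDerivAt_comp hF
  have hl := (hlin_right l).hasFDerivAt_comp hF
  refine ⟨hk.differentiableAt, hl.differentiableAt, ?_⟩
  rw [hk.fderiv, hl.fderiv]
  change mul l (fderiv ℝ F w (mul k (F w))) = mul k (fderiv ℝ F w (mul l (F w)))
  rw [hd, hd]
  have : Std.Associative mul := ⟨hassoc⟩
  have : Std.Commutative mul := ⟨hcomm⟩
  ac_rfl
end
end

section
/- Let A be R^3 endowed with a commutative, associative, unital bilinear product with unit e, let F be A-algebrizable on an open set Omega in R^3, and let w0 in Omega be a point where F(w0) is invertible in A. Then there exist an open neighborhood N of w0 contained in Omega(F,A*) = {w in Omega : F(w) is invertible in A} and a map H : N -> R^3 such that: (i) at every w in N, H is Fréchet differentiable with differential xi |-> (F(w))^{-1}·xi (product in A), i.e., H is an A-antiderivative of e/F on N; (ii) H is injective on N; and (iii) for every w in N, DH(w)(F(w)) = e, i.e., H rectifies F, pushing F forward to the constant vector field e. -/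
noncomputable section

section CommutativeProduct

variable {E : Type*} [NormedAddCommGroup E] [NormedSpace ℝ E] {L : E →L[ℝ] E →L[ℝ] E} {e : E}

/-- Left multiplication by an invertible element, as a unit of the algebra of operators. -/
def mulLeftUnit (hcomm : ∀ x y, L x y = L y x) (hassoc : ∀ x y z, L (L x y) z = L x (L y z))
    (hunit : ∀ x, L e x = x) (a v : E) (h : L a v = e) : (E →L[ℝ] E)ˣ where
  val := L a
  inv := L v
  val_inv := by ext x; simp [← hassoc, h, hunit]
  inv_val := by ext x; simp [← hassoc, hcomm v a, h, hunit]

theorem isUnit_mulLeft_iff (hcomm : ∀ x y, L x y = L y x)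
    (hassoc : ∀ x y z, L (L x y) z = L x (L y z)) (hunit : ∀ x, L e x = x) (a : E) :
    IsUnit (L a) ↔ ∃ v, L a v = e := by
  constructor
  · rintro ⟨u, hu⟩
    refine ⟨(↑u⁻¹ : E →L[ℝ] E) e, ?_⟩
    rw [← hu, ← mul_apply_eq_comp, u.mul_inv, one_apply_eq_self]
  · rintro ⟨v, h⟩
    exact ⟨mulLeftUnit hcomm hassoc hunit a v h, rfl⟩

theorem ringInverse_mulLeft (hcomm : ∀ x y, L x y = L y x)
    (hassoc : ∀ x y z, L (L x y) z = L x (L y z)) (hunit : ∀ x, L e x = x) {a v : E}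
    (h : L a v = e) : Ring.inverse (L a) = L v :=
  Ring.inverse_unit (mulLeftUnit hcomm hassoc hunit a v h)

variable [CompleteSpace E]

/-- The derivative of `w ↦ (F w)⁻¹`, where inversion is that of multiplication operators. -/
theorem hasFDerivAt_ringInverse_mulLeft (hcomm : ∀ x y, L x y = L y x)
    (hassoc : ∀ x y z, L (L x y) z = L x (L y z)) (hunit : ∀ x, L e x = x) {F : E → E} {w c v : E}
    (hF : HasFDerivAt F (L c) w) (h : L (F w) v = e) :
    HasFDerivAt (fun x => Ring.inverse (L (F x)))
      ((-ContinuousLinearMap.mulLeftRight ℝ (E →L[ℝ] E) (L v) (L v)).comp (L.comp (L c))) w :=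
  HasFDerivAt.comp (f := fun x => L (F x)) w
    (hasFDerivAt_ringInverse (𝕜 := ℝ) (mulLeftUnit hcomm hassoc hunit (F w) v h))
    (L.hasFDerivAt.comp w hF)

/-- The reciprocal of a differentiable function (in the sense of Lorch) with invertible values
has an antiderivative on every open convex set. -/
theorem exists_antiderivative_ringInverse_mulLeft (hcomm : ∀ x y, L x y = L y x)
    (hassoc : ∀ x y z, L (L x y) z = L x (L y z)) (hunit : ∀ x, L e x = x) {F F' : E → E}
    {s : Set E} (hs : Convex ℝ s) (hso : IsOpen s) (hF : ∀ w ∈ s, HasFDerivAt F (L (F' w)) w)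
    (hinv : ∀ w ∈ s, ∃ v, L (F w) v = e) :
    ∃ H : E → E, ∀ w ∈ s, HasFDerivAt H (Ring.inverse (L (F w))) w := by
  refine hs.exists_forall_hasFDerivAt_of_fderiv_symmetric hso (fun w hw => ?_) fun w hw x y => ?_
  all_goals
    obtain ⟨v, hv⟩ := hinv w hw
    have hd := hasFDerivAt_ringInverse_mulLeft hcomm hassoc hunit (hF w hw) hv
  · exact hd.differentiableAt.differentiableWithinAt
  · rw [hd.fderiv]
    have key : L v (L (L (F' w) x) (L v y)) = L v (L (L (F' w) y) (L v x)) := by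
      rw [hassoc, hassoc, ← hassoc x, ← hassoc y, hcomm x v, hcomm y v, hassoc, hassoc, hcomm x y]
    simpa using key

/-- A function which is differentiable near a point, with derivative continuous and invertible at
that point, is injective near that point. -/
theorem exists_isOpen_injOn_of_isUnit_fderiv {H : E → E} {H' : E → E →L[ℝ] E} {a : E}
    (hH : ∀ᶠ w in nhds a, HasFDerivAt H (H' w) w) (hc : ContinuousAt H' a) (hu : IsUnit (H' a)) :
    ∃ U : Set E, IsOpen U ∧ a ∈ U ∧ Set.InjOn H U := by
  obtain ⟨u, hu⟩ := hu
  have hstrict : HasStrictFDerivAt H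
      ((ContinuousLinearEquiv.unitsEquiv ℝ E u : E ≃L[ℝ] E) : E →L[ℝ] E) a := by
    have := hasStrictFDerivAt_of_hasFDerivAt_of_continuousAt hH hc
    rw [← hu] at this
    exact this
  exact ⟨_, (hstrict.toOpenPartialHomeomorph H).open_source,
    hstrict.mem_toOpenPartialHomeomorph_source, (hstrict.toOpenPartialHomeomorph H).injOn⟩

end CommutativeProduct

/-- Let `A` be `ℝ³` with a commutative, associative, unital bilinear product with
unit `eu`, `F` `A`-algebrizable on an open set `Ω`, and `w₀ ∈ Ω` with `F(w₀)`
invertible.  Then there are an open neighborhood `N` of `w₀` inside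
`Ω(F,A*) = {w ∈ Ω : F(w)` invertible`}` and a map `H : N → ℝ³` such that (i) at each
`w ∈ N`, `H` is Fréchet differentiable with differential `ξ ↦ (F(w))⁻¹·ξ` (an
`A`-antiderivative of `e/F`), (ii) `H` is injective on `N`, and (iii)
`DH(w)(F(w)) = eu` for every `w ∈ N`, i.e. `H` rectifies `F`. -/
theorem stmt19 (mul : (Fin 3 → ℝ) → (Fin 3 → ℝ) → (Fin 3 → ℝ))
    (hlin_left : ∀ y, IsLinearMap ℝ (fun x => mul x y))
    (hlin_right : ∀ x, IsLinearMap ℝ (mul x))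
    (hcomm : ∀ x y, mul x y = mul y x)
    (hassoc : ∀ x y z, mul (mul x y) z = mul x (mul y z))
    (eu : Fin 3 → ℝ) (hunit : ∀ x, mul eu x = x)
    (Ω : Set (Fin 3 → ℝ)) (hΩ : IsOpen Ω)
    (F : (Fin 3 → ℝ) → (Fin 3 → ℝ)) (halg : IsAlgebrizable mul Ω F)
    (w0 : Fin 3 → ℝ) (hw0 : w0 ∈ Ω) (hinv0 : ∃ v, mul (F w0) v = eu) :
    ∃ (N : Set (Fin 3 → ℝ)) (H : (Fin 3 → ℝ) → (Fin 3 → ℝ)),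
      IsOpen N ∧ w0 ∈ N ∧ N ⊆ {w ∈ Ω | ∃ v, mul (F w) v = eu} ∧
      (∀ w ∈ N, ∀ v, mul (F w) v = eu →
        DifferentiableAt ℝ H w ∧ ∀ ξ, fderiv ℝ H w ξ = mul v ξ) ∧
      Set.InjOn H N ∧
      (∀ w ∈ N, fderiv ℝ H w (F w) = eu) := by
  obtain ⟨F', hF'⟩ := halg
  obtain ⟨L, hL⟩ : ∃ L : (Fin 3 → ℝ) →L[ℝ] (Fin 3 → ℝ) →L[ℝ] (Fin 3 → ℝ),
      ∀ x y, L x y = mul x y :=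
    ⟨LinearMap.toContinuousLinearMap (LinearMap.toContinuousLinearMap.toLinearMap ∘ₗ
      LinearMap.mk₂ ℝ mul (fun x y z => (hlin_left z).map_add x y)
        (fun c x z => (hlin_left z).map_smul c x) (fun x => (hlin_right x).map_add)
        (fun c x => (hlin_right x).map_smul c)), fun _ _ => rfl⟩
  obtain rfl : (fun x y => L x y) = mul := funext fun x => funext (hL x)
  have hF : ∀ w ∈ Ω, HasFDerivAt F (L (F' w)) w := fun w hw => by
    have h := (hF' w hw).1.hasFDerivAt
    rwa [ContinuousLinearMap.ext (hF' w hw).2] at h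
  have hopen : IsOpen {w ∈ Ω | ∃ v, L (F w) v = eu} := by
    have hcont : ContinuousOn (fun w => L (F w)) Ω := fun w hw =>
      (L.continuous.continuousAt.comp (hF w hw).continuousAt).continuousWithinAt
    convert! hcont.isOpen_inter_preimage hΩ Units.isOpen using 1
    ext w
    exact and_congr_right fun _ => (isUnit_mulLeft_iff hcomm hassoc hunit (F w)).symm
  obtain ⟨r, hr, hball⟩ := Metric.isOpen_iff.1 hopen w0 ⟨hw0, hinv0⟩
  obtain ⟨H, hH⟩ := exists_antiderivative_ringInverse_mulLeft hcomm hassoc hunit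
    (convex_ball w0 r) Metric.isOpen_ball (fun w hw => hF w (hball hw).1)
    (fun w hw => (hball hw).2)
  obtain ⟨v₀, hv₀⟩ := hinv0
  obtain ⟨U, hU, hw0U, hinj⟩ := exists_isOpen_injOn_of_isUnit_fderiv
    (Filter.mem_of_superset (Metric.ball_mem_nhds w0 hr) hH)
    (hasFDerivAt_ringInverse_mulLeft hcomm hassoc hunit (hF w0 hw0) hv₀).continuousAt
    (((isUnit_mulLeft_iff hcomm hassoc hunit (F w0)).2 ⟨v₀, hv₀⟩).ringInverse)
  refine ⟨Metric.ball w0 r ∩ U, H, Metric.isOpen_ball.inter hU, ⟨Metric.mem_ball_self hr, hw0U⟩,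
    fun w hw => hball hw.1, fun w hw v hv => ⟨(hH w hw.1).differentiableAt, fun ξ => ?_⟩,
    hinj.mono Set.inter_subset_right, fun w hw => ?_⟩
  · rw [(hH w hw.1).fderiv, ringInverse_mulLeft hcomm hassoc hunit hv]
  · obtain ⟨v, hv⟩ := (hball hw.1).2
    rw [(hH w hw.1).fderiv, ringInverse_mulLeft hcomm hassoc hunit hv]
    exact (hcomm v (F w)).trans hv
end
end
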